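/- arXiv:2402.01078 — 2 statements merged into one kernel-verified Lean document; each statement's English description precedes it below -/
import Mathlib

section
/- Let 𝕂 be a field and V a 𝕂-vector space with finrank V = 2g, equipped with a nondegenerate alternating bilinear form B. Let i ≤ j ≤ g, let v₁, v₂ be isotropic subspaces with finrank v₁ = finrank v₂ = i and finrank (v₁ ⊔ v₂) ≤ j, and let u₁ be an isotropic subspace with finrank u₁ = j and v₁ ≤ u₁. Then there exists an isotropic subspace u₂ with finrank u₂ = j, v₂ ≤ u₂, and finrank (u₁ ⊓ u₂) ≥ i. -/
open LinearMap (BilinForm)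
open Module

namespace Submodule

/-- Submodules of every intermediate dimension exist between two nested subspaces. -/
theorem exists_le_le_finrank_eq {K E : Type*} [DivisionRing K] [AddCommGroup E] [Module K E]
    [FiniteDimensional K E] {P Q : Submodule K E} (hPQ : P ≤ Q) {n : ℕ}
    (hP : finrank K P ≤ n) (hQ : n ≤ finrank K Q) :
    ∃ R : Submodule K E, P ≤ R ∧ R ≤ Q ∧ finrank K R = n := by
  induction n, hP using Nat.le_induction with
  | base => exact ⟨P, le_rfl, hPQ, rfl⟩
  | succ n _ ih =>
    obtain ⟨R, hPR, hRQ, hR⟩ := ih (by lia)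
    have hQR : ¬ Q ≤ R := fun h => by
      have := finrank_mono h
      lia
    obtain ⟨x, hxQ, hxR⟩ := SetLike.not_le_iff_exists.mp hQR
    refine ⟨R ⊔ span K {x}, hPR.trans le_sup_left,
      sup_le hRQ ((span_singleton_le_iff_mem _ _).mpr hxQ), ?_⟩
    rw [finrank_sup_span_singleton hxR, hR]

end Submodule

namespace LinearMap.BilinForm

variable {K E : Type*} [Field K] [AddCommGroup E] [Module K E] {B : BilinForm K E}

/-- For isotropic `u` and `v`, the subspace `v ⊔ (u ⊓ vᗮ)` is isotropic. -/
theorem isotropic_sup_inf_orthogonal (hB : B.IsRefl) {u v : Submodule K E}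
    (hu : u ≤ B.orthogonal u) (hv : v ≤ B.orthogonal v) :
    v ⊔ u ⊓ B.orthogonal v ≤ B.orthogonal (v ⊔ u ⊓ B.orthogonal v) := by
  intro x hx y hy
  obtain ⟨a, ha, b, ⟨hbu, hbv⟩, rfl⟩ := Submodule.mem_sup.mp hx
  obtain ⟨c, hc, d, ⟨hdu, hdv⟩, rfl⟩ := Submodule.mem_sup.mp hy
  have hca : B c a = 0 := hv ha c hc
  have hcb : B c b = 0 := hbv c hc
  have hda : B d a = 0 := hB _ _ (hdv a ha)
  have hdb : B d b = 0 := hu hbu d hdu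
  simp [hca, hcb, hda, hdb]

/-- If `u` is isotropic, then passing to `v ⊔ (u ⊓ vᗮ)` does not lower the dimension of `u`. -/
theorem finrank_le_finrank_sup_inf_orthogonal [FiniteDimensional K E]
    (hnd : B.Nondegenerate) {u v : Submodule K E} (hu : u ≤ B.orthogonal u)
    (hv : v ≤ B.orthogonal v) :
    finrank K u ≤ finrank K ↥(v ⊔ u ⊓ B.orthogonal v) := by
  have hle : u ⊔ B.orthogonal v ≤ B.orthogonal (u ⊓ v) :=
    sup_le (hu.trans (orthogonal_le inf_le_left)) (orthogonal_le inf_le_right)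
  have hmono := Submodule.finrank_mono hle
  have hinf : v ⊓ (u ⊓ B.orthogonal v) = u ⊓ v := by
    rw [inf_left_comm, inf_eq_left.mpr hv]
  have h₁ := Submodule.finrank_sup_add_finrank_inf_eq u (B.orthogonal v)
  have h₂ := Submodule.finrank_sup_add_finrank_inf_eq v (u ⊓ B.orthogonal v)
  rw [hinf] at h₂
  rw [finrank_orthogonal hnd] at hmono h₁
  have h₃ := Submodule.finrank_le v
  have h₄ := Submodule.finrank_le (u ⊓ v)
  lia

end LinearMap.BilinForm

/-- In a `2g`-dimensional symplectic space: given `i`-dimensional isotropic subspaces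
`v₁, v₂` whose sum has dimension at most `j`, and a `j`-dimensional isotropic `u₁ ⊇ v₁`,
there is a `j`-dimensional isotropic `u₂ ⊇ v₂` with `dim (u₁ ⊓ u₂) ≥ i`. -/
theorem exists_isotropic_with_large_intersection
    (𝕂 : Type*) [Field 𝕂] (V : Type*) [AddCommGroup V] [Module 𝕂 V]
    (g : ℕ) (hdim : finrank 𝕂 V = 2 * g) (B : BilinForm 𝕂 V)
    (halt : ∀ x : V, B x x = 0) (hnd : B.Nondegenerate)
    (i j : ℕ) (hij : i ≤ j) (hjg : j ≤ g)
    (v₁ v₂ : Submodule 𝕂 V)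
    (hv₁ : ∀ x ∈ v₁, ∀ y ∈ v₁, B x y = 0) (hv₂ : ∀ x ∈ v₂, ∀ y ∈ v₂, B x y = 0)
    (hd₁ : finrank 𝕂 v₁ = i) (hd₂ : finrank 𝕂 v₂ = i)
    (hsum : finrank 𝕂 ↥(v₁ ⊔ v₂) ≤ j)
    (u₁ : Submodule 𝕂 V) (hu₁ : ∀ x ∈ u₁, ∀ y ∈ u₁, B x y = 0)
    (hdu₁ : finrank 𝕂 u₁ = j) (hv₁u₁ : v₁ ≤ u₁) :
    ∃ u₂ : Submodule 𝕂 V,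
      (∀ x ∈ u₂, ∀ y ∈ u₂, B x y = 0) ∧ finrank 𝕂 u₂ = j ∧ v₂ ≤ u₂ ∧
      i ≤ finrank 𝕂 ↥(u₁ ⊓ u₂) := by
  have hB : B.IsRefl := LinearMap.IsAlt.isRefl halt
  rcases Nat.eq_zero_or_pos g with rfl | hg
  · exact ⟨v₂, hv₂, by lia, le_rfl, by lia⟩
  have : FiniteDimensional 𝕂 V := .of_finrank_pos (by lia)
  have hu : u₁ ≤ B.orthogonal u₁ := fun x hx y hy => hu₁ y hy x hx
  have hv : v₂ ≤ B.orthogonal v₂ := fun x hx y hy => hv₂ y hy x hx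
  obtain ⟨u₂, hv₂u₂, hu₂, hdu₂⟩ := Submodule.exists_le_le_finrank_eq
    (le_sup_left : v₂ ≤ v₂ ⊔ u₁ ⊓ B.orthogonal v₂) (hd₂.trans_le hij)
    (hdu₁ ▸ LinearMap.BilinForm.finrank_le_finrank_sup_inf_orthogonal hnd hu hv)
  refine ⟨u₂, fun x hx y hy =>
    LinearMap.BilinForm.isotropic_sup_inf_orthogonal hB hu hv (hu₂ hy) x (hu₂ hx),
    hdu₂, hv₂u₂, ?_⟩
  have hsup : u₁ ⊔ u₂ ≤ u₁ ⊔ v₂ :=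
    sup_le le_sup_left (hu₂.trans (sup_le le_sup_right (inf_le_left.trans le_sup_left)))
  have h₁ := Submodule.finrank_mono hsup
  have h₂ := Submodule.finrank_mono (inf_le_inf_right v₂ hv₁u₁)
  have h₃ := Submodule.finrank_sup_add_finrank_inf_eq u₁ u₂
  have h₄ := Submodule.finrank_sup_add_finrank_inf_eq u₁ v₂
  have h₅ := Submodule.finrank_sup_add_finrank_inf_eq v₁ v₂
  lia
end

section
/- Let m ≥ 2 and g be natural numbers with (g : ℝ) ≥ 100 · Real.sqrt (m · Real.log m), and let q be a prime. Let Sp denote the finite symplectic group Matrix.symplecticGroup (Fin g) (ZMod q) of 2g × 2g symplectic matrices over the field with q elements, and let PSp = Sp ⧸ Subgroup.center Sp be the projective symplectic group. Then Nat.card PSp > m! (Nat.factorial m). -/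
open Matrix in
/-- The unipotent symplectic matrix `[[1, S], [0, 1]]` attached to the symmetric matrix `S`
with entries `S i j = f s(i, j)`. -/
def symplecticUnipotent {l R : Type*} [DecidableEq l] [Fintype l] [CommRing R]
    (f : Sym2 l → R) : Matrix.symplecticGroup l R :=
  ⟨Matrix.fromBlocks 1 (Matrix.of fun i j => f s(i, j)) 0 1, by
    have h : (Matrix.of fun i j => f s(i, j))ᵀ = Matrix.of fun i j => f s(i, j) := by
      ext i j
      simp [Sym2.eq_swap]
    rw [SymplecticGroup.fromBlocks_mem_iff]
    simp [h]⟩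

theorem symplecticUnipotent_mul {l R : Type*} [DecidableEq l] [Fintype l] [CommRing R]
    (f h : Sym2 l → R) :
    symplecticUnipotent f * symplecticUnipotent h = symplecticUnipotent (f + h) := by
  apply Subtype.ext
  simp only [symplecticUnipotent, Submonoid.coe_mul, Matrix.fromBlocks_multiply]
  congr 1 <;> ext i j <;> simp [add_comm]

theorem symplecticUnipotent_eq_zero_of_mem_center {l R : Type*} [DecidableEq l] [Fintype l]
    [CommRing R] {f : Sym2 l → R}
    (hf : symplecticUnipotent f ∈ Subgroup.center (Matrix.symplecticGroup l R)) : f = 0 := by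
  have h := congrArg Subtype.val (Subgroup.mem_center_iff.1 hf (SymplecticGroup.symJ l R))
  simp only [symplecticUnipotent, Submonoid.coe_mul, SymplecticGroup.coe_J, Matrix.J,
    Matrix.fromBlocks_multiply, Matrix.fromBlocks_inj] at h
  funext z
  induction z with
  | _ i j =>
    have := congrFun (congrFun h.1 i) j
    simpa using this.symm

theorem symplecticUnipotent_mk_injective {l R : Type*} [DecidableEq l] [Fintype l]
    [CommRing R] :
    Function.Injective fun f : Sym2 l → R =>
      (symplecticUnipotent f : Matrix.symplecticGroup l R ⧸
        Subgroup.center (Matrix.symplecticGroup l R)) := by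
  intro f h hfh
  have hc := QuotientGroup.eq.1 hfh
  have hmul : (symplecticUnipotent f)⁻¹ * symplecticUnipotent h
      = symplecticUnipotent (h - f) := by
    rw [inv_mul_eq_iff_eq_mul, symplecticUnipotent_mul, add_sub_cancel]
  rw [hmul] at hc
  exact (sub_eq_zero.1 (symplecticUnipotent_eq_zero_of_mem_center hc)).symm

theorem pow_choose_le_card_projective_symplectic (g : ℕ) (R : Type*) [CommRing R] [Finite R] :
    Nat.card R ^ (g + 1).choose 2 ≤
      Nat.card (Matrix.symplecticGroup (Fin g) R ⧸
        Subgroup.center (Matrix.symplecticGroup (Fin g) R)) := by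
  have : Finite (Matrix (Fin g ⊕ Fin g) (Fin g ⊕ Fin g) R) :=
    inferInstanceAs (Finite (Fin g ⊕ Fin g → Fin g ⊕ Fin g → R))
  have h := Nat.card_le_card_of_injective _ (symplecticUnipotent_mk_injective (l := Fin g) (R := R))
  rwa [Nat.card_fun, Nat.card_eq_fintype_card (α := Sym2 (Fin g)), Sym2.card,
    Fintype.card_fin] at h

theorem factorial_lt_two_pow_choose {m g : ℕ} (hm : 2 ≤ m)
    (hg : 100 * Real.sqrt (m * Real.log m) ≤ g) : m.factorial < 2 ^ (g + 1).choose 2 := by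
  have hm' : (2 : ℝ) ≤ m := by exact_mod_cast hm
  have hlog : 0 < Real.log m := Real.log_pos (by linarith)
  have hx : 0 < m * Real.log m := by positivity
  have hsq : 10000 * (m * Real.log m) ≤ (g : ℝ) ^ 2 := by
    have h := pow_le_pow_left₀ (by positivity) hg 2
    rw [mul_pow, Real.sq_sqrt hx.le] at h
    linarith
  have hchoose : (((g + 1).choose 2 : ℕ) : ℝ) = (g + 1) * g / 2 := by
    rw [Nat.cast_choose_two]
    push_cast
    ring
  have hlt : m * Real.log m < (g + 1).choose 2 * Real.log 2 := by
    rw [hchoose]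
    have := Real.log_two_gt_d9
    nlinarith [Nat.cast_nonneg (α := ℝ) g]
  have hpow : (m : ℝ) ^ m < 2 ^ (g + 1).choose 2 := by
    rw [← Real.log_lt_log_iff (by positivity) (by positivity), Real.log_pow, Real.log_pow]
    exact hlt
  exact (Nat.factorial_le_pow m).trans_lt (by exact_mod_cast hpow)

/-- For `m ≥ 2` and `g ≥ 100√(m log m)`, the projective symplectic group `PSp(2g, F_q)`
has cardinality greater than `m!`. -/
theorem card_projective_symplectic_gt_factorial
    (m : ℕ) (hm : 2 ≤ m) (g : ℕ)
    (hg : (g : ℝ) ≥ 100 * Real.sqrt (m * Real.log m))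
    (q : ℕ) [Fact q.Prime] :
    Nat.card
      ((Matrix.symplecticGroup (Fin g) (ZMod q)) ⧸
        Subgroup.center (Matrix.symplecticGroup (Fin g) (ZMod q)))
      > m.factorial := by
  have hq : 2 ≤ Nat.card (ZMod q) := by
    rw [Nat.card_zmod]
    exact (Fact.out : q.Prime).two_le
  exact ((factorial_lt_two_pow_choose hm hg).trans_le (Nat.pow_le_pow_left hq _)).trans_le
    (pow_choose_le_card_projective_symplectic g (ZMod q))
end
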